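/- arXiv:2407.08724 — 8 statements merged into one kernel-verified Lean document; each statement's English description precedes it below -/
import Mathlib

section
/- Let F be a field and let φ, φ̄, D ∈ F with D ≠ 0 and φ + φ̄ + D·φ·φ̄ = 0. For n ∈ ℕ define Φ(n) = ((1 + φ·D)^n − 1)/D and Φ̄(n) = ((1 + φ̄·D)^n − 1)/D. Then for every n ∈ ℕ one has Φ(n) + Φ̄(n) + D·Φ(n)·Φ̄(n) = 0. -/
/-- Cancellation of a chain of n locks with the opposite chain of n locks. -/
theorem chain_cancellation
    (F : Type*) [Field F] (φ φbar D : F) (hD : D ≠ 0)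
    (h : φ + φbar + D * φ * φbar = 0)
    (Φ Φbar : ℕ → F)
    (hΦ : ∀ n : ℕ, Φ n = ((1 + φ * D) ^ n - 1) / D)
    (hΦbar : ∀ n : ℕ, Φbar n = ((1 + φbar * D) ^ n - 1) / D) :
    ∀ n : ℕ, Φ n + Φbar n + D * Φ n * Φbar n = 0 := by
  intro n
  have hmul : (1 + φ * D) * (1 + φbar * D) = 1 := by linear_combination D * h
  have hpow : (1 + φ * D) ^ n * (1 + φbar * D) ^ n = 1 := by
    rw [← mul_pow, hmul, one_pow]
  rw [hΦ, hΦbar]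
  field_simp
  linear_combination hpow
end

section
/- Let F be a field, q, A ∈ F with q ≠ 0, A ≠ 0, q − q⁻¹ ≠ 0 and A − A⁻¹ ≠ 0. Write {x} = x − x⁻¹, D = {A}/{q}, φ = A{q}. Then for every n ∈ ℕ: A^{−2n}·(D² − 1 + (1 + φ·D)^n) = D²·(1 + ({Aq}·{A/q}/{A})·((A^{−2n} − 1)/{A})). In particular, the cyclotomic function of the anti-parallel torus link APT[2,2n] equals (A^{−2n} − 1)/{A}. -/
/-- Differential expansion of the HOMFLY polynomial of the anti-parallel torus
link APT[2,2n]: its cyclotomic function is `(A^{−2n} − 1)/{A}`. -/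
theorem APT_cyclotomic
    (F : Type*) [Field F] (q A : F) (hq : q ≠ 0) (hA : A ≠ 0)
    (hqq : q - q⁻¹ ≠ 0) (hAA : A - A⁻¹ ≠ 0)
    (D φ : F)
    (hD : D = (A - A⁻¹) / (q - q⁻¹))
    (hφ : φ = A * (q - q⁻¹)) :
    ∀ n : ℕ,
      A ^ (-(2 * (n : ℤ))) * (D ^ 2 - 1 + (1 + φ * D) ^ n) =
      D ^ 2 * (1 + ((A * q - (A * q)⁻¹) * (A / q - (A / q)⁻¹) / (A - A⁻¹)) *
        ((A ^ (-(2 * (n : ℤ))) - 1) / (A - A⁻¹))) := by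
  intro n
  have hφD : 1 + φ * D = A ^ 2 := by
    rw [hφ, hD, mul_assoc, mul_div_cancel₀ _ hqq, mul_sub, mul_inv_cancel₀ hA]
    ring
  have hprod : (A * q - (A * q)⁻¹) * (A / q - (A / q)⁻¹) =
      (A - A⁻¹) ^ 2 - (q - q⁻¹) ^ 2 := by
    field_simp
    ring
  have hpow : A ^ (-(2 * (n : ℤ))) * (A ^ 2) ^ n = 1 := by
    rw [← pow_mul, ← zpow_natCast, ← zpow_add₀ hA]
    simp
  rw [hφD, hprod, mul_add, hpow, hD]
  generalize A ^ (-(2 * (n : ℤ))) = x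
  generalize A - A⁻¹ = a at hAA ⊢
  generalize q - q⁻¹ = b at hqq ⊢
  field_simp
  ring
end

section
/- Let F be a field, q, A ∈ F with q ≠ 0, A ≠ 0, q − q⁻¹ ≠ 0 and A − A⁻¹ ≠ 0. Write {x} = x − x⁻¹, D = {A}/{q}, φ = A{q}. Then for all m, n ∈ ℕ: A^{−2n−2m}·D·((1+φD)^n + (1+φD)^m + D^{−2}·((1+φD)^n − 1)·((1+φD)^m − 1) − 1) = D·(1 − (1 − A^{−2m})·(1 − A^{−2n})·{Aq}·{A/q}/{A}²). In particular, the cyclotomic function of the double braid DB(2m,2n) factorizes as −(1 − A^{−2m})(1 − A^{−2n})/{A}². -/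
/-- The difference of squares `{Aq}{A/q} = {A}² − {q}²`. -/
theorem brace_mul_mul_brace_div {F : Type*} [Field F] {q A : F} (hq : q ≠ 0) (hA : A ≠ 0) :
    (A * q - (A * q)⁻¹) * (A / q - (A / q)⁻¹) = (A - A⁻¹) ^ 2 - (q - q⁻¹) ^ 2 := by
  field_simp
  ring


/-- The cyclotomic function of the double braid DB(2m,2n) factorizes:
`F = −(1 − A^{−2m})(1 − A^{−2n})/{A}²`. -/
theorem double_braid_factorization
    (F : Type*) [Field F] (q A : F) (hq : q ≠ 0) (hA : A ≠ 0)
    (hqq : q - q⁻¹ ≠ 0) (hAA : A - A⁻¹ ≠ 0)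
    (D φ : F)
    (hD : D = (A - A⁻¹) / (q - q⁻¹))
    (hφ : φ = A * (q - q⁻¹)) :
    ∀ m n : ℕ,
      A ^ (-(2 * (n : ℤ)) - 2 * (m : ℤ)) * D *
        ((1 + φ * D) ^ n + (1 + φ * D) ^ m +
          (D ^ 2)⁻¹ * ((1 + φ * D) ^ n - 1) * ((1 + φ * D) ^ m - 1) - 1) =
      D * (1 - (1 - A ^ (-(2 * (m : ℤ)))) * (1 - A ^ (-(2 * (n : ℤ)))) *
        ((A * q - (A * q)⁻¹) * (A / q - (A / q)⁻¹)) / (A - A⁻¹) ^ 2) := by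
  intro m n
  have lock : 1 + φ * D = A ^ 2 := by
    rw [hD, hφ, mul_assoc, mul_div_cancel₀ _ hqq, mul_sub, mul_inv_cancel₀ hA]
    ring
  have inv_pow_two_mul (k : ℕ) : A ^ (-(2 * (k : ℤ))) = ((A ^ 2) ^ k)⁻¹ := by
    rw [zpow_neg, ← pow_mul]
    norm_cast
  have hDinv : (D ^ 2)⁻¹ = (q - q⁻¹) ^ 2 / (A - A⁻¹) ^ 2 := by
    rw [hD, div_pow, inv_div]
  rw [lock, brace_mul_mul_brace_div hq hA, sub_eq_add_neg (-(2 * (n : ℤ))), zpow_add₀ hA,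
    inv_pow_two_mul, inv_pow_two_mul, hDinv]
  have hX : (A ^ 2) ^ n ≠ 0 := pow_ne_zero _ (pow_ne_zero _ hA)
  have hY : (A ^ 2) ^ m ≠ 0 := pow_ne_zero _ (pow_ne_zero _ hA)
  generalize (A ^ 2) ^ n = X at *
  generalize (A ^ 2) ^ m = Y at *
  generalize A - A⁻¹ = a at *
  generalize q - q⁻¹ = b at *
  field_simp
  ring
end

section
/- Let F be a field, q, A ∈ F with q ≠ 0, A ≠ 0, q − q⁻¹ ≠ 0 and A − A⁻¹ ≠ 0. Write {x} = x − x⁻¹, D = {A}/{q}. Then for every n ∈ ℕ: A^{−2−2n}·D·(A² + A^{2n} + D^{−2}·(A² − 1)·(A^{2n} − 1) − 1) = D·(A^{−2} + A^{−1}·{q}²/{A} + ({A/q}·{Aq}/{A})·A^{−2n−1}). -/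
/-- The standard formula for the fundamental HOMFLY polynomial of the twist
knot Tw_{2n} = DB(2,2n). -/
theorem twist_knot_homfly
    (F : Type*) [Field F] (q A : F) (hq : q ≠ 0) (hA : A ≠ 0)
    (hqq : q - q⁻¹ ≠ 0) (hAA : A - A⁻¹ ≠ 0)
    (D : F) (hD : D = (A - A⁻¹) / (q - q⁻¹)) :
    ∀ n : ℕ,
      A ^ (-2 - 2 * (n : ℤ)) * D *
        (A ^ 2 + A ^ (2 * (n : ℤ)) + (D ^ 2)⁻¹ * (A ^ 2 - 1) * (A ^ (2 * (n : ℤ)) - 1) - 1) =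
      D * ((A ^ 2)⁻¹ + A⁻¹ * (q - q⁻¹) ^ 2 / (A - A⁻¹) +
        ((A / q - (A / q)⁻¹) * (A * q - (A * q)⁻¹) / (A - A⁻¹)) * A ^ (-2 * (n : ℤ) - 1)) := by
  intro n
  have key : (A / q - (A / q)⁻¹) * (A * q - (A * q)⁻¹) =
      (A - A⁻¹) ^ 2 - (q - q⁻¹) ^ 2 := by
    field_simp
    ring
  have hfac : A ^ 2 - 1 = A * (A - A⁻¹) := by
    field_simp
  have hB : A ^ (2 * (n : ℤ)) ≠ 0 := zpow_ne_zero _ hA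
  have hl : A ^ (-2 - 2 * (n : ℤ)) = (A ^ 2)⁻¹ * (A ^ (2 * (n : ℤ)))⁻¹ := by
    rw [sub_eq_add_neg, zpow_add₀ hA, zpow_neg, zpow_neg]
    norm_cast
  have hr : A ^ (-2 * (n : ℤ) - 1) = (A ^ (2 * (n : ℤ)))⁻¹ * A⁻¹ := by
    rw [zpow_sub_one₀ hA, neg_mul, zpow_neg]
  have hsum : A ^ 2 + A ^ (2 * (n : ℤ)) +
        (D ^ 2)⁻¹ * (A ^ 2 - 1) * (A ^ (2 * (n : ℤ)) - 1) - 1 =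
      (A ^ 2 - 1) * (1 + (D ^ 2)⁻¹ * (A ^ (2 * (n : ℤ)) - 1)) + A ^ (2 * (n : ℤ)) := by
    ring
  have hDinv : (D ^ 2)⁻¹ = (q - q⁻¹) ^ 2 / (A - A⁻¹) ^ 2 := by
    rw [hD, div_pow, inv_div]
  rw [mul_comm _ D, mul_assoc, hsum, hDinv, hfac, key, hl, hr]
  clear hD hDinv hsum hl hr key hfac
  generalize A ^ (2 * (n : ℤ)) = B at *
  generalize A - A⁻¹ = a at *
  generalize q - q⁻¹ = z at *
  congr 1
  field_simp
  ring
end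

section
/- Let F be a field and let φ, φ̄, D ∈ F with D ≠ 0 and φ + φ̄ + D·φ·φ̄ = 0. For k ∈ ℕ set Φ(k) = ((1 + φ·D)^k − 1)/D, and for m, n ∈ ℕ set P1(m,n) = D·(1 + D·Φ(m+n)), P2(m,n) = D·(1 + D·Φ(n))·(D + Φ(m)), P3(m,n) = D·(D + Φ(m))·(D + Φ(n)), P4(m,n) = P3(m,n) − D·(D² − 1). Then for all m, n ∈ ℕ: (1 + φ²·φ̄²)·P1(m,n) + (φ + φ̄ + (φ + φ̄ + D)·φ·φ̄)·(P2(m,n) + P2(n,m)) + (φ² + φ̄²)·P3(m,n) + 2·φ·φ̄·P4(m,n) = D²·Φ(m+n) + D·(1 + (D − D⁻¹)·(φ + φ̄))². In particular this expression depends on m and n only through the sum m + n. -/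
/-- Planar evaluation of the Kanenobu knot Kan(2m,2n): the sum over the 16
resolutions equals `D²·Φ(m+n) + D·(1 + (D − D⁻¹)(φ + φ̄))²`, which depends on
m and n only through m + n. -/
theorem kanenobu_evaluation
    (F : Type*) [Field F] (φ φbar D : F) (hD : D ≠ 0)
    (h : φ + φbar + D * φ * φbar = 0)
    (Φ : ℕ → F) (hΦ : ∀ k : ℕ, Φ k = ((1 + φ * D) ^ k - 1) / D)
    (P1 P2 P3 P4 : ℕ → ℕ → F)
    (hP1 : ∀ m n : ℕ, P1 m n = D * (1 + D * Φ (m + n)))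
    (hP2 : ∀ m n : ℕ, P2 m n = D * (1 + D * Φ n) * (D + Φ m))
    (hP3 : ∀ m n : ℕ, P3 m n = D * (D + Φ m) * (D + Φ n))
    (hP4 : ∀ m n : ℕ, P4 m n = P3 m n - D * (D ^ 2 - 1)) :
    ∀ m n : ℕ,
      (1 + φ ^ 2 * φbar ^ 2) * P1 m n
        + (φ + φbar + (φ + φbar + D) * φ * φbar) * (P2 m n + P2 n m)
        + (φ ^ 2 + φbar ^ 2) * P3 m n
        + 2 * φ * φbar * P4 m n
      = D ^ 2 * Φ (m + n) + D * (1 + (D - D⁻¹) * (φ + φbar)) ^ 2 := by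
  intro m n
  have hadd : Φ (m + n) = Φ m + Φ n + D * Φ m * Φ n := by
    rw [hΦ, hΦ, hΦ, pow_add]
    field_simp
    ring
  have hbase : (D - D⁻¹) * (φ + φbar) = -((D ^ 2 - 1) * (φ * φbar)) := by
    rw [show φ + φbar = -(D * φ * φbar) by linear_combination h]
    field_simp
  rw [hbase, hP4, hP1, hP2, hP2, hP3, hadd]
  linear_combination
    (1 + φ * φbar) * (D * (1 + D * Φ n) * (D + Φ m) + D * (1 + D * Φ m) * (D + Φ n)) * h
      + (φ + φbar - D * φ * φbar) * (D * (D + Φ m) * (D + Φ n)) * h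
end

section
/- Let F be a field, φ, D ∈ F with D ≠ 0, and define Φ(k) = ((1 + φ·D)^k − 1)/D for k ∈ ℕ. Let ι be a finite type (or let s be a finite set of indices) and m : ι → ℕ. Then the sum over all nonempty subsets S of s of D^{|S|−1}·∏_{i∈S} Φ(m(i)) equals Φ(∑_{i∈s} m(i)). -/
/-- The sum over all nonempty subsets S of a finite index set of
`D^{|S|−1}·∏_{i∈S} Φ(m i)` equals `Φ(∑ m i)`, where
`Φ k = ((1 + φD)^k − 1)/D`. -/
theorem subset_sum_chain
    (F : Type*) [Field F] (φ D : F) (hD : D ≠ 0)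
    (Φ : ℕ → F) (hΦ : ∀ k : ℕ, Φ k = ((1 + φ * D) ^ k - 1) / D)
    (ι : Type*) [DecidableEq ι] (s : Finset ι) (m : ι → ℕ) :
    ∑ S ∈ s.powerset.filter (fun S => S.Nonempty),
        D ^ (S.card - 1) * ∏ i ∈ S, Φ (m i)
      = Φ (∑ i ∈ s, m i) := by
  have mul_chain (k : ℕ) : D * Φ k + 1 = (1 + φ * D) ^ k := by
    rw [hΦ, mul_div_cancel₀ _ hD, sub_add_cancel]
  have sum_powerset : ∑ S ∈ s.powerset, ∏ i ∈ S, D * Φ (m i) = (1 + φ * D) ^ ∑ i ∈ s, m i := by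
    rw [← Finset.prod_add_one, Finset.prod_congr rfl fun i _ => mul_chain (m i),
      Finset.prod_pow_eq_pow_sum]
  have filter_nonempty : s.powerset.filter (fun S => S.Nonempty) = s.powerset.erase ∅ := by
    ext S
    simp [Finset.nonempty_iff_ne_empty, and_comm]
  rw [hΦ, eq_div_iff hD, ← sum_powerset, ← Finset.sum_erase_add _ _ (Finset.empty_mem_powerset s),
    Finset.prod_empty, add_sub_cancel_right, ← filter_nonempty, Finset.sum_mul]
  refine Finset.sum_congr rfl fun S hS => ?_
  have card_ne_zero : S.card ≠ 0 := (Finset.mem_filter.mp hS).2.card_ne_zero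
  rw [Finset.prod_mul_distrib, Finset.prod_const, mul_right_comm, pow_sub_one_mul card_ne_zero]
end

section
/- Let F be the field of fractions of the polynomial ring ℚ[x₀, x₁] in two indeterminates, and write q and A for the images of x₀ and x₁ in F. Set {x} = x − x⁻¹, D = {A}/{q}, φ = A{q}, φ̄ = −A⁻¹{q}. Then D·(D + φ)·((D + φ̄)·(1 + φ·(D + φ)) + φ) + D·φ·φ̄·(1 + φ·D) ≠ D·(1 + φ² + 2·φ·D). -/
/-- Clearing denominators in the equality of the two planar evaluations. -/
theorem cleared_of_planar_evaluation_eq {K : Type*} [Field K] {q A : K} (hq : q ≠ 0) (hA : A ≠ 0)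
    (hq2 : q ^ 2 - 1 ≠ 0) (hA2 : A ^ 2 - 1 ≠ 0)
    (h : let D := (A - A⁻¹) / (q - q⁻¹)
      let φ := A * (q - q⁻¹)
      let φbar := -A⁻¹ * (q - q⁻¹)
      D * (D + φ) * ((D + φbar) * (1 + φ * (D + φ)) + φ) + D * φ * φbar * (1 + φ * D) =
        D * (1 + φ ^ 2 + 2 * φ * D)) :
    ((A ^ 2 - 1) * q ^ 2 + A ^ 2 * (q ^ 2 - 1) ^ 2) *
          (((A ^ 2 - 1) * q ^ 2 - (q ^ 2 - 1) ^ 2) * (A ^ 2 * q ^ 2 + A ^ 2 * (q ^ 2 - 1) ^ 2) +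
            A ^ 2 * q ^ 2 * (q ^ 2 - 1) ^ 2) -
        A ^ 4 * q ^ 2 * (q ^ 2 - 1) ^ 4 =
      A ^ 2 * q ^ 2 * (q ^ 2 - 1) ^ 2 *
        (q ^ 2 + A ^ 2 * (q ^ 2 - 1) ^ 2 + 2 * (A ^ 2 - 1) * q ^ 2) := by
  have hqinv : q - q⁻¹ = (q ^ 2 - 1) / q := by field_simp
  have hAinv : A - A⁻¹ = (A ^ 2 - 1) / A := by field_simp
  simp only [hqinv, hAinv] at h
  field_simp at h
  linear_combination h

open MvPolynomial in
theorem planar_evaluation_ne_of_isFractionRing (K : Type*) [Field K]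
    [Algebra (MvPolynomial (Fin 2) ℚ) K] [IsFractionRing (MvPolynomial (Fin 2) ℚ) K] :
    let q : K := algebraMap (MvPolynomial (Fin 2) ℚ) K (X 0)
    let A : K := algebraMap (MvPolynomial (Fin 2) ℚ) K (X 1)
    let D : K := (A - A⁻¹) / (q - q⁻¹)
    let φ : K := A * (q - q⁻¹)
    let φbar : K := -A⁻¹ * (q - q⁻¹)
    D * (D + φ) * ((D + φbar) * (1 + φ * (D + φ)) + φ) + D * φ * φbar * (1 + φ * D) ≠
      D * (1 + φ ^ 2 + 2 * φ * D) := by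
  intro q A D φ φbar h
  have inj := IsFractionRing.injective (MvPolynomial (Fin 2) ℚ) K
  have ne_zero (p : MvPolynomial (Fin 2) ℚ) (hp : eval ![3, 2] p ≠ 0) :
      algebraMap _ K p ≠ 0 :=
    (map_ne_zero_iff _ inj).mpr fun h0 ↦ hp (by rw [h0, map_zero])
  have sq_sub_one_ne_zero (i : Fin 2) (hi : eval ![3, 2] (X i ^ 2 - 1 : MvPolynomial _ ℚ) ≠ 0) :
      algebraMap (MvPolynomial (Fin 2) ℚ) K (X i) ^ 2 - 1 ≠ 0 := by
    simpa only [map_sub, map_pow, map_one] using ne_zero _ hi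
  have hcleared := cleared_of_planar_evaluation_eq (ne_zero (X 0) (by simp))
    (ne_zero (X 1) (by simp)) (sq_sub_one_ne_zero 0 (by norm_num))
    (sq_sub_one_ne_zero 1 (by norm_num)) h
  rw [← map_one (algebraMap (MvPolynomial (Fin 2) ℚ) K),
    ← map_ofNat (algebraMap (MvPolynomial (Fin 2) ℚ) K) 2] at hcleared
  simp only [← map_mul, ← map_add, ← map_sub, ← map_pow] at hcleared
  have heval := congrArg (eval ![3, 2]) (inj hcleared)
  norm_num at heval


/-- In the field of rational functions in q and A, the planar evaluation of the
deformed Kanenobu tangle differs from that of the double braid DB(2,2). -/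
theorem deformed_kanenobu_ne_double_braid :
    let F := FractionRing (MvPolynomial (Fin 2) ℚ)
    let q : F := algebraMap (MvPolynomial (Fin 2) ℚ) F (MvPolynomial.X 0)
    let A : F := algebraMap (MvPolynomial (Fin 2) ℚ) F (MvPolynomial.X 1)
    let D : F := (A - A⁻¹) / (q - q⁻¹)
    let φ : F := A * (q - q⁻¹)
    let φbar : F := -A⁻¹ * (q - q⁻¹)
    D * (D + φ) * ((D + φbar) * (1 + φ * (D + φ)) + φ) + D * φ * φbar * (1 + φ * D) ≠
      D * (1 + φ ^ 2 + 2 * φ * D) :=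
  planar_evaluation_ne_of_isFractionRing _
end

section
/- Let F be a field, q, A ∈ F with q ≠ 0, A ≠ 0, q − q⁻¹ ≠ 0 and A − A⁻¹ ≠ 0. Write {x} = x − x⁻¹ (for integer powers, {A^k} = A^k − A^{−k}), D = {A}/{q}. For k ∈ ℤ set Φ(k) = (A^{2k} − 1)/D and Φ̄(k) = (A^{−2k} − 1)/D. Then for all m, n ∈ ℕ and all j ∈ ℤ: A^{−2m−2n}·D·( D·Φ(m+n) + (1 + (D − D⁻¹)·(Φ(j) + Φ̄(j)))² ) = D·( 1 + {Aq}·{A/q}·A^{−2m−2n}·({A^j}/{A})²·( 2 + {Aq}·{A/q}·({A^j}/{A})² ) ). -/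
/-- Differential expansion of the HOMFLY polynomial of the 3-parameter
Kanenobu knot Kan(2m,2n,2j): the dependence on m+n factorizes from the
dependence on j in the cyclotomic function. -/
theorem kanenobu_three_parameter
    (F : Type*) [Field F] (q A : F) (hq : q ≠ 0) (hA : A ≠ 0)
    (hqq : q - q⁻¹ ≠ 0) (hAA : A - A⁻¹ ≠ 0)
    (D : F) (hD : D = (A - A⁻¹) / (q - q⁻¹))
    (Φ Φbar : ℤ → F)
    (hΦ : ∀ k : ℤ, Φ k = (A ^ (2 * k) - 1) / D)
    (hΦbar : ∀ k : ℤ, Φbar k = (A ^ (-(2 * k)) - 1) / D)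
    (br : ℤ → F) (hbr : ∀ k : ℤ, br k = A ^ k - A ^ (-k)) :
    ∀ (m n : ℕ) (j : ℤ),
      A ^ (-(2 * (m : ℤ)) - 2 * (n : ℤ)) * D *
        (D * Φ ((m : ℤ) + n) + (1 + (D - D⁻¹) * (Φ j + Φbar j)) ^ 2) =
      D * (1 + (A * q - (A * q)⁻¹) * (A / q - (A / q)⁻¹) *
        A ^ (-(2 * (m : ℤ)) - 2 * (n : ℤ)) * (br j / (A - A⁻¹)) ^ 2 *
          (2 + (A * q - (A * q)⁻¹) * (A / q - (A / q)⁻¹) * (br j / (A - A⁻¹)) ^ 2)) := by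
  intro m n j
  have hD0 : D ≠ 0 := hD ▸ div_ne_zero hAA hqq
  have hbracket : (A * q - (A * q)⁻¹) * (A / q - (A / q)⁻¹) =
      (A - A⁻¹) ^ 2 - (q - q⁻¹) ^ 2 := by
    field_simp
    ring
  have hcoeff : (D - D⁻¹) / D =
      ((A - A⁻¹) ^ 2 - (q - q⁻¹) ^ 2) / (A - A⁻¹) ^ 2 := by
    rw [hD]
    generalize A - A⁻¹ = a at *
    generalize q - q⁻¹ = c at *
    field_simp
  have hsum : Φ j + Φbar j = br j ^ 2 / D := by
    have hAj : A ^ j * A ^ (-j) = 1 := by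
      rw [← zpow_add₀ hA, add_neg_cancel, zpow_zero]
    rw [hΦ, hΦbar, hbr, ← add_div, show 2 * j = j + j by ring, neg_add,
      zpow_add₀ hA, zpow_add₀ hA]
    congr 1
    linear_combination 2 * hAj
  have hX : (D - D⁻¹) * (Φ j + Φbar j) =
      (A * q - (A * q)⁻¹) * (A / q - (A / q)⁻¹) * (br j / (A - A⁻¹)) ^ 2 := by
    rw [hsum, hbracket, div_pow, ← mul_div_assoc, mul_div_right_comm, hcoeff]
    ring
  have hE : A ^ (-(2 * (m : ℤ)) - 2 * (n : ℤ)) * A ^ (2 * ((m : ℤ) + n)) = 1 := by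
    rw [← zpow_add₀ hA, show -(2 * (m : ℤ)) - 2 * n + 2 * ((m : ℤ) + n) = 0 by ring, zpow_zero]
  rw [hX, hΦ, mul_div_cancel₀ _ hD0]
  linear_combination D * hE
end
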